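/- Consider the homogeneous stochastic block model with N nodes, K blocks and probability mass functions f, g on a finite set S, and set I = D_{1/2}(f‖g). For real numbers a ≤ b let Z_{a,b} be the set of node labellings σ : {1,…,N} → {1,…,K} with a·N/K ≤ |σ^{-1}(k)| ≤ b·N/K for all k. Let σ̂ be any estimator from the set X of symmetric S-valued arrays to {1,…,K}^N satisfying the maximum-likelihood property P_{σ̂(x)}(x) ≥ P_{σ'}(x) for all σ' and all x. Then for all 0 ≤ ε ≤ ζ ≤ 1/21, with κ = 56 max{K² exp(−(1/8) N I / K), K/N}: max over σ ∈ Z_{1−ε,1+ε} of E_σ Ham*(σ, σ̂(x)) ≤ 8 e N (K−1) exp(−(1 − ζ − κ) N I / K) + N K^N exp(−(1/4)(ζ/(K−1) − ε)(N/K)² I), where E_σ denotes expectation of x under P_σ. -/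

import Mathlib

open Finset

/-- Hamming distance between two node labellings. -/
def ham {N K : ℕ} (σ₁ σ₂ : Fin N → Fin K) : ℕ :=
  (Finset.univ.filter fun i => σ₁ i ≠ σ₂ i).card

/-- Absolute classification error: minimum Hamming distance over relabellings of `σ₂`. -/
def hamStar {N K : ℕ} (σ₁ σ₂ : Fin N → Fin K) : ℕ :=
  Finset.univ.inf' Finset.univ_nonempty fun ρ : Equiv.Perm (Fin K) =>
    ham σ₁ (fun i => ρ (σ₂ i))

/-- Number of nodes with label `k` under the labelling `σ`. -/
def blockCount {N K : ℕ} (σ : Fin N → Fin K) (k : Fin K) : ℕ :=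
  (Finset.univ.filter fun i => σ i = k).card

/-- Index type for unordered pairs of distinct nodes, represented by ordered pairs `i < j`. -/
abbrev PairIdx (N : ℕ) := {p : Fin N × Fin N // p.1 < p.2}

/-- Probability assigned by the homogeneous SBM with labelling `σ`, intra-block interaction
distribution `f` and inter-block interaction distribution `g`, to the data array `x`. -/
noncomputable def sbmProb {N K : ℕ} {S : Type*} [Fintype S] (f g : S → ℝ)
    (σ : Fin N → Fin K) (x : PairIdx N → S) : ℝ :=
  ∏ p : PairIdx N, (if σ p.1.1 = σ p.1.2 then f (x p) else g (x p))

/-- Unordered pairs of nodes on which exactly one of the two labellings is constant. -/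
def discordantPairs {N K : ℕ} (σ σ' : Fin N → Fin K) : Finset (PairIdx N) :=
  Finset.univ.filter fun p => ¬(σ p.1.1 = σ p.1.2 ↔ σ' p.1.1 = σ' p.1.2)

lemma card_le_card_discordantPairs {N K : ℕ} (σ σ' : Fin N → Fin K)
    (T : Finset (Fin N × Fin N))
    (hT : ∀ p ∈ T, ¬(σ p.1 = σ p.2 ↔ σ' p.1 = σ' p.2))
    (hanti : ∀ p ∈ T, p.swap ∉ T) :
    T.card ≤ (discordantPairs σ σ').card := by
  rw [← Finset.card_map (Function.Embedding.subtype _)]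
  refine Finset.card_le_card_of_injOn (fun p => if p.1 < p.2 then p else p.swap) ?_ ?_
  · rintro ⟨i, j⟩ hp
    have h := hT _ hp
    have hne : i ≠ j := by rintro rfl; simp at h
    simp only [Finset.coe_map, Set.mem_image, Finset.mem_coe, discordantPairs,
      Finset.mem_filter, Finset.mem_univ, true_and]
    rcases lt_or_gt_of_ne hne with hij | hij
    · exact ⟨⟨(i, j), hij⟩, h, by simp [hij]⟩
    · refine ⟨⟨(j, i), hij⟩, ?_, by simp [hij.not_gt]⟩
      simpa [eq_comm] using h
  · intro p hp p' hp' h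
    dsimp only at h
    split_ifs at h
    · exact h
    · exact absurd hp (h ▸ hanti _ hp')
    · exact absurd hp' (h ▸ hanti _ hp)
    · exact Prod.swap_injective h

lemma card_le_two_mul_card_discordantPairs {N K : ℕ} (σ σ' : Fin N → Fin K)
    (T : Finset (Fin N × Fin N))
    (hT : ∀ p ∈ T, ¬(σ p.1 = σ p.2 ↔ σ' p.1 = σ' p.2)) :
    T.card ≤ 2 * (discordantPairs σ σ').card := by
  have h1 := card_le_card_discordantPairs σ σ' (T.filter fun p => p.1 < p.2)
    (fun p hp => hT p (Finset.mem_filter.1 hp).1) (by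
      intro p hp hp'
      have := (Finset.mem_filter.1 hp).2
      have := (Finset.mem_filter.1 hp').2
      simp only [Prod.fst_swap, Prod.snd_swap] at this
      order)
  have h2 := card_le_card_discordantPairs σ σ' (T.filter fun p => ¬ p.1 < p.2)
    (fun p hp => hT p (Finset.mem_filter.1 hp).1) (by
      intro p hp hp'
      have h1 := (Finset.mem_filter.1 hp).2
      have h2 := (Finset.mem_filter.1 hp').2
      simp only [Prod.fst_swap, Prod.snd_swap] at h2
      have h3 : p.1 = p.2 := by order
      have h4 := hT p (Finset.mem_filter.1 hp).1
      simp [h3] at h4)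
  have := Finset.card_filter_add_card_filter_not (s := T) (fun p => p.1 < p.2)
  omega

lemma two_mul_ham_le_card_discordantPairs {N K : ℕ} (σ σ' : Fin N → Fin K) (c : ℝ)
    (hc : ∀ k, c ≤ ((Finset.univ.filter fun i => σ i = k ∧ σ' i = k).card : ℝ)) :
    2 * c * ham σ σ' ≤ ((discordantPairs σ σ').card : ℝ) := by
  set T : Finset (Fin N × Fin N) := Finset.univ.filter fun p =>
    σ p.1 = σ' p.1 ∧ σ p.2 ≠ σ' p.2 ∧ (σ p.2 = σ p.1 ∨ σ' p.2 = σ p.1) with hTdef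
  have hT : T.card ≤ (discordantPairs σ σ').card := by
    apply card_le_card_discordantPairs
    · intro p hp
      have := (Finset.mem_filter.1 hp).2
      grind
    · intro p hp hp'
      have := (Finset.mem_filter.1 hp).2
      have := (Finset.mem_filter.1 hp').2
      simp only [Prod.fst_swap, Prod.snd_swap] at this
      grind
  refine le_trans ?_ (Nat.cast_le.2 hT)
  rw [Finset.card_eq_sum_card_fiberwise (f := Prod.snd)
    (t := Finset.univ.filter fun i => σ i ≠ σ' i)
    (fun p hp => by
      have := (Finset.mem_filter.1 hp).2
      simp [this.2.1])]
  rw [ham, mul_comm, ← nsmul_eq_mul, ← Finset.sum_const, Nat.cast_sum]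
  refine Finset.sum_le_sum fun j hj => ?_
  have hj' : σ j ≠ σ' j := (Finset.mem_filter.1 hj).2
  set A := Finset.univ.filter fun i => σ i = σ j ∧ σ' i = σ j
  set B := Finset.univ.filter fun i => σ i = σ' j ∧ σ' i = σ' j
  have hAB : Disjoint A B := by
    rw [Finset.disjoint_left]
    intro i hi hi'
    have := (Finset.mem_filter.1 hi).2
    have := (Finset.mem_filter.1 hi').2
    grind
  have hle : (A ∪ B).card ≤ (T.filter fun p => p.2 = j).card := by
    refine Finset.card_le_card_of_injOn (fun i => (i, j)) ?_ ?_
    · intro i hi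
      simp only [A, B, T, Finset.coe_union, Finset.coe_filter, Set.mem_union,
        Set.mem_ofPred_eq, Finset.mem_univ, true_and, Finset.mem_filter] at hi ⊢
      grind
    · intro i _ i' _ h
      exact (Prod.ext_iff.1 h).1
  rw [Finset.card_union_of_disjoint hAB] at hle
  have h1 := hc (σ j)
  have h2 := hc (σ' j)
  have h3 : ((A.card + B.card : ℕ) : ℝ) ≤ ((T.filter fun p => p.2 = j).card : ℝ) :=
    Nat.cast_le.2 hle
  push_cast at h3
  linarith

/-- A labelling with few discordant pairs relative to `σ` almost contains each block of `σ`
in one of its own blocks. -/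
lemma exists_label_overlap {N K : ℕ} (σ σ' : Fin N → Fin K) (k : Fin K) (L : ℝ) (hL : 0 < L)
    (hblock : 20 / 21 * L ≤ (blockCount σ k : ℝ))
    (hd : ((discordantPairs σ σ').card : ℝ) < L ^ 2 / 42) :
    ∃ l, ((Finset.univ.filter fun i => σ i = k ∧ σ' i ≠ l).card : ℝ) ≤ L / 20 := by
  have : Nonempty (Fin K) := ⟨k⟩
  obtain ⟨l, hl⟩ := Finite.exists_min fun l =>
    (Finset.univ.filter fun i => σ i = k ∧ σ' i ≠ l).card
  refine ⟨l, ?_⟩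
  set u := (Finset.univ.filter fun i => σ i = k ∧ σ' i ≠ l).card with hu
  set T : Finset (Fin N × Fin N) := Finset.univ.filter fun p =>
    σ p.1 = k ∧ σ p.2 = k ∧ σ' p.2 ≠ σ' p.1 with hTdef
  have hT : T.card ≤ 2 * (discordantPairs σ σ').card := by
    apply card_le_two_mul_card_discordantPairs
    intro p hp
    have := (Finset.mem_filter.1 hp).2
    grind
  have hT2 : blockCount σ k * u ≤ T.card := by
    rw [Finset.card_eq_sum_card_fiberwise (f := Prod.fst)
      (t := Finset.univ.filter fun i => σ i = k)
      (fun p hp => by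
        have := (Finset.mem_filter.1 hp).2
        simp [this.1])]
    rw [blockCount, ← smul_eq_mul, ← Finset.sum_const]
    refine Finset.sum_le_sum fun i hi => ?_
    have hi' : σ i = k := (Finset.mem_filter.1 hi).2
    refine (hl (σ' i)).trans ?_
    refine Finset.card_le_card_of_injOn (fun j => (i, j)) ?_ ?_
    · intro j hj
      simp only [T, Finset.coe_filter, Set.mem_ofPred_eq, Finset.mem_univ, true_and,
        Finset.mem_filter] at hj ⊢
      grind
    · intro j _ j' _ h
      exact (Prod.ext_iff.1 h).2
  have h3 : ((blockCount σ k : ℝ)) * u ≤ 2 * ((discordantPairs σ σ').card : ℝ) := by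
    exact_mod_cast hT2.trans hT
  have hu0 : (0 : ℝ) ≤ u := Nat.cast_nonneg _
  have h4 : 20 / 21 * L * u ≤ L ^ 2 / 21 := by
    have := mul_le_mul_of_nonneg_right hblock hu0
    linarith
  have h5 : L * (20 * u) ≤ L * L := by nlinarith
  have := le_of_mul_le_mul_left h5 hL
  linarith

lemma exists_perm_aligned {N K : ℕ} (σ σ' : Fin N → Fin K) (L : ℝ) (hL : 0 < L)
    (hblock : ∀ k, 20 / 21 * L ≤ (blockCount σ k : ℝ))
    (hd : ((discordantPairs σ σ').card : ℝ) < L ^ 2 / 42) :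
    ∃ ρ : Equiv.Perm (Fin K), ∀ k,
      ((Finset.univ.filter fun i => σ i = k ∧ ρ (σ' i) ≠ k).card : ℝ) ≤ L / 20 := by
  choose τ hτ using fun k => exists_label_overlap σ σ' k L hL (hblock k) hd
  have hover : ∀ k,
      9 / 10 * L ≤ ((Finset.univ.filter fun i => σ i = k ∧ σ' i = τ k).card : ℝ) := by
    intro k
    have h := Finset.card_filter_add_card_filter_not
      (s := Finset.univ.filter fun i => σ i = k) (fun i => σ' i = τ k)
    rw [Finset.filter_filter, Finset.filter_filter] at h
    have h1 := hτ k
    have h2 := hblock k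
    rw [blockCount, ← h] at h2
    push_cast at h2
    linarith
  have hinj : Function.Injective τ := by
    intro k k' h
    by_contra hne
    have hT := card_le_card_discordantPairs σ σ'
      ((Finset.univ.filter fun i => σ i = k ∧ σ' i = τ k) ×ˢ
        (Finset.univ.filter fun i => σ i = k' ∧ σ' i = τ k'))
      (by
        intro p hp
        simp only [Finset.mem_product, Finset.mem_filter, Finset.mem_univ, true_and] at hp
        grind)
      (by
        intro p hp
        simp only [Finset.mem_product, Finset.mem_filter, Finset.mem_univ, true_and,
          Prod.fst_swap, Prod.snd_swap] at hp ⊢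
        grind)
    rw [Finset.card_product] at hT
    have hT' : ((Finset.univ.filter fun i => σ i = k ∧ σ' i = τ k).card : ℝ) *
        ((Finset.univ.filter fun i => σ i = k' ∧ σ' i = τ k').card : ℝ) ≤
        ((discordantPairs σ σ').card : ℝ) := by exact_mod_cast hT
    have h1 := hover k
    have h2 := hover k'
    have h3 := mul_le_mul h1 h2 (by positivity) (by positivity)
    nlinarith [sq_nonneg L, mul_pos hL hL]
  let e : Equiv.Perm (Fin K) := Equiv.ofBijective τ (Finite.injective_iff_bijective.1 hinj)
  refine ⟨e.symm, fun k => ?_⟩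
  simp only [ne_eq, Equiv.symm_apply_eq]
  exact hτ k

lemma sbmProb_nonneg {N K : ℕ} {S : Type*} [Fintype S] {f g : S → ℝ}
    (hf0 : ∀ x, 0 ≤ f x) (hg0 : ∀ x, 0 ≤ g x) (σ : Fin N → Fin K) (x : PairIdx N → S) :
    0 ≤ sbmProb f g σ x :=
  Finset.prod_nonneg fun p _ => by split_ifs <;> simp [hf0, hg0]

lemma sbmProb_perm {N K : ℕ} {S : Type*} [Fintype S] (f g : S → ℝ)
    (σ : Fin N → Fin K) (ρ : Equiv.Perm (Fin K)) (x : PairIdx N → S) :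
    sbmProb f g (fun i => ρ (σ i)) x = sbmProb f g σ x := by
  simp [sbmProb]

lemma sum_sbmProb {N K : ℕ} {S : Type*} [Fintype S] {f g : S → ℝ}
    (hf1 : ∑ x, f x = 1) (hg1 : ∑ x, g x = 1) (σ : Fin N → Fin K) :
    ∑ x : PairIdx N → S, sbmProb f g σ x = 1 := by
  classical
  have h := Finset.prod_univ_sum (fun _ : PairIdx N => (Finset.univ : Finset S))
    (fun p s => if σ p.1.1 = σ p.1.2 then f s else g s)
  rw [Fintype.piFinset_univ] at h
  simp only [sbmProb]
  rw [← h]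
  refine Finset.prod_eq_one fun p _ => ?_
  split_ifs <;> assumption

/-- The Bhattacharyya coefficient of two block models factorises over discordant pairs. -/
lemma sum_sqrt_sbmProb_mul {N K : ℕ} {S : Type*} [Fintype S] {f g : S → ℝ}
    (hf0 : ∀ x, 0 ≤ f x) (hg0 : ∀ x, 0 ≤ g x)
    (hf1 : ∑ x, f x = 1) (hg1 : ∑ x, g x = 1) (σ σ' : Fin N → Fin K) :
    ∑ x : PairIdx N → S, Real.sqrt (sbmProb f g σ x * sbmProb f g σ' x) =
      (∑ s, Real.sqrt (f s * g s)) ^ (discordantPairs σ σ').card := by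
  classical
  have h := Finset.prod_univ_sum (fun _ : PairIdx N => (Finset.univ : Finset S))
    (fun p s => Real.sqrt ((if σ p.1.1 = σ p.1.2 then f s else g s) *
      (if σ' p.1.1 = σ' p.1.2 then f s else g s)))
  rw [Fintype.piFinset_univ] at h
  have h2 : ∀ x : PairIdx N → S, Real.sqrt (sbmProb f g σ x * sbmProb f g σ' x) =
      ∏ p, Real.sqrt ((if σ p.1.1 = σ p.1.2 then f (x p) else g (x p)) *
      (if σ' p.1.1 = σ' p.1.2 then f (x p) else g (x p))) := by
    intro x
    rw [sbmProb, sbmProb, ← Finset.prod_mul_distrib, Real.sqrt_eq_iff_mul_self_eq,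
      ← Finset.prod_mul_distrib]
    · refine Finset.prod_congr rfl fun p _ => ?_
      rw [Real.mul_self_sqrt]
      split_ifs <;> simp [hf0, hg0, mul_nonneg]
    · refine Finset.prod_nonneg fun p _ => ?_
      split_ifs <;> simp [hf0, hg0, mul_nonneg]
    · exact Finset.prod_nonneg fun p _ => Real.sqrt_nonneg _
  simp only [h2]
  rw [← h, discordantPairs, ← Finset.prod_const, Finset.prod_filter]
  refine Finset.prod_congr rfl fun p _ => ?_
  by_cases h1 : σ p.1.1 = σ p.1.2 <;> by_cases h3 : σ' p.1.1 = σ' p.1.2 <;>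
    simp [h1, h3, Real.sqrt_mul_self, hf0, hg0, hf1, hg1, mul_comm]

lemma sum_sqrt_mul_le_one {S : Type*} [Fintype S] {f g : S → ℝ}
    (hf0 : ∀ x, 0 ≤ f x) (hg0 : ∀ x, 0 ≤ g x)
    (hf1 : ∑ x, f x = 1) (hg1 : ∑ x, g x = 1) : ∑ s, Real.sqrt (f s * g s) ≤ 1 := by
  have h : ∑ s, Real.sqrt (f s * g s) ≤ ∑ s, (f s + g s) / 2 := by
    refine Finset.sum_le_sum fun s _ => ?_
    have hf := hf0 s
    have hg := hg0 s
    rw [Real.sqrt_le_left (by positivity)]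
    nlinarith [sq_nonneg (f s - g s)]
  rw [← Finset.sum_div, Finset.sum_add_distrib, hf1, hg1] at h
  linarith

lemma pow_le_exp_of_eq_log {w I : ℝ} (hw : 0 ≤ w) (hI : I = -2 * Real.log w) (d : ℕ) :
    w ^ d ≤ Real.exp (-(I * d / 2)) := by
  rcases hw.eq_or_lt with rfl | hpos
  · simp only [Real.log_zero, mul_zero] at hI
    subst hI
    simpa using pow_le_one₀ (n := d) le_rfl zero_le_one
  · rw [hI, show -(-2 * Real.log w * d / 2) = d * Real.log w by ring, ← Real.log_pow,
      Real.exp_log (pow_pos hpos d)]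

/-- Chernoff-type bound on the size of a Hamming sphere. -/
lemma card_ham_eq_le {N K : ℕ} (hN : 0 < N) (hK : 2 ≤ K) (σ : Fin N → Fin K) {m : ℕ}
    (hm : 0 < m) :
    ((Finset.univ.filter fun σ' => ham σ σ' = m).card : ℝ) ≤
      (Real.exp 1 * N * ((K : ℝ) - 1) / m) ^ m := by
  have hN' : (0 : ℝ) < N := by exact_mod_cast hN
  have hK' : (0 : ℝ) < (K : ℝ) - 1 := by
    have : (2 : ℝ) ≤ K := by exact_mod_cast hK
    linarith
  have hm' : (0 : ℝ) < m := by exact_mod_cast hm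
  set t : ℝ := m / (N * ((K : ℝ) - 1)) with ht
  have htpos : 0 < t := by positivity
  have hpow : ∀ σ' : Fin N → Fin K, t ^ ham σ σ' = ∏ i, if σ i ≠ σ' i then t else 1 := by
    intro σ'
    rw [ham, ← Finset.prod_const, Finset.prod_filter]
  have hgen : ∑ σ' : Fin N → Fin K, t ^ ham σ σ' = (1 + ((K : ℝ) - 1) * t) ^ N := by
    have h := Finset.prod_univ_sum (fun _ : Fin N => (Finset.univ : Finset (Fin K)))
      (fun i l => if σ i ≠ l then t else 1)
    rw [Fintype.piFinset_univ] at h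
    simp only [hpow]
    rw [← h]
    have : ∀ i, (∑ l, if σ i ≠ l then t else 1) = 1 + ((K : ℝ) - 1) * t := by
      intro i
      rw [← Finset.add_sum_erase _ _ (Finset.mem_univ (σ i)),
        Finset.sum_congr rfl (g := fun _ => t) (fun l hl => by
          simp [(Finset.ne_of_mem_erase hl).symm])]
      simp [Finset.card_erase_of_mem, Nat.cast_sub (by omega : 1 ≤ K)]
    rw [Finset.prod_congr rfl fun i _ => this i]
    simp
  have hle : ((Finset.univ.filter fun σ' => ham σ σ' = m).card : ℝ) * t ^ m ≤
      Real.exp m := by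
    calc ((Finset.univ.filter fun σ' => ham σ σ' = m).card : ℝ) * t ^ m
        = ∑ σ' ∈ Finset.univ.filter (fun σ' => ham σ σ' = m), t ^ ham σ σ' := by
          rw [← nsmul_eq_mul, ← Finset.sum_const]
          exact Finset.sum_congr rfl fun σ' h => by rw [(Finset.mem_filter.1 h).2]
      _ ≤ ∑ σ' : Fin N → Fin K, t ^ ham σ σ' :=
          Finset.sum_le_sum_of_subset_of_nonneg (Finset.filter_subset _ _)
            fun _ _ _ => by positivity
      _ = (1 + ((K : ℝ) - 1) * t) ^ N := hgen
      _ ≤ Real.exp (((K : ℝ) - 1) * t) ^ N := by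
          gcongr
          linarith [Real.add_one_le_exp (((K : ℝ) - 1) * t)]
      _ = Real.exp m := by
          rw [← Real.exp_nat_mul, ht]
          congr 1
          field_simp
  have heq : (Real.exp 1 * N * ((K : ℝ) - 1) / m) ^ m = Real.exp m / t ^ m := by
    rw [← Real.exp_one_pow, ← div_pow, ht]
    congr 1
    field_simp
  rw [heq, le_div_iff₀ (by positivity)]
  exact hle

lemma sphere_term_le {N K A ε ζ κ : ℝ} (hN : 0 < N) (hK : 2 ≤ K) (hA : 0 ≤ A)
    (hε0 : 0 ≤ ε) (hεζ : ε ≤ ζ) (hζ : ζ ≤ 1 / 21)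
    (hκ1 : 56 * (K ^ 2 * Real.exp (-(1 / 8) * A)) ≤ κ) (hκ2 : 56 * (K / N) ≤ κ)
    (m : ℕ) (hm : 0 < m)
    (hqm : 4 * (Real.exp 1 * N * (K - 1) * Real.exp (-(1 - ζ - κ) * A)) < m) :
    (Real.exp 1 * N * (K - 1) / m) ^ m *
        (m * Real.exp (-(m * A * (1 - ε - min (m * K / N) (1 / 20))))) ≤
      Real.exp 1 * N * (K - 1) * Real.exp (-(1 - ζ - κ) * A) * (1 / 4) ^ (m - 1) := by
  set c : ℝ := Real.exp 1 * N * (K - 1) with hc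
  set s : ℝ := min (m * K / N) (1 / 20) with hs
  have hcpos : 0 < c := by
    have : 0 < K - 1 := by linarith
    positivity
  have hm' : (0 : ℝ) < m := by exact_mod_cast hm
  have hκpos : 0 < κ := lt_of_lt_of_le (by positivity) hκ1
  set r : ℝ := c / m * Real.exp (-(A * (1 - ε - s))) with hr
  have hrpos : 0 ≤ r := by positivity
  have hlhs : (c / m) ^ m * (m * Real.exp (-(m * A * (1 - ε - s)))) =
      (c * Real.exp (-(A * (1 - ε - s)))) * r ^ (m - 1) := by
    have h1 : Real.exp (-(m * A * (1 - ε - s))) = Real.exp (-(A * (1 - ε - s))) ^ m := by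
      rw [← Real.exp_nat_mul]
      congr 1
      ring
    have h2 : c * Real.exp (-(A * (1 - ε - s))) = m * r := by
      rw [hr]
      field_simp
    rw [h1, h2, mul_assoc, ← pow_succ', Nat.sub_add_cancel hm, hr, mul_pow]
    ring
  rw [hlhs]
  rcases le_or_gt s κ with hsκ | hsκ
  · have hexp : Real.exp (-(A * (1 - ε - s))) ≤ Real.exp (-(1 - ζ - κ) * A) := by
      apply Real.exp_le_exp.2
      nlinarith
    have hr4 : r ≤ 1 / 4 := by
      have : r * m ≤ 1 / 4 * m := by
        calc r * m = c * Real.exp (-(A * (1 - ε - s))) := by rw [hr]; field_simp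
          _ ≤ c * Real.exp (-(1 - ζ - κ) * A) := by gcongr
          _ ≤ 1 / 4 * m := by linarith
      exact le_of_mul_le_mul_right this hm'
    gcongr
  · have hκ20 : κ < 1 / 20 := hsκ.trans_le (min_le_right _ _)
    have hκm : κ < m * K / N := hsκ.trans_le (min_le_left _ _)
    have hKN : 0 < K / N := by positivity
    have hm56 : (56 : ℝ) < m := by
      have : 56 * (K / N) < m * (K / N) := by
        calc 56 * (K / N) ≤ κ := hκ2
          _ < m * K / N := hκm
          _ = m * (K / N) := by ring
      exact lt_of_mul_lt_mul_right this hKN.le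
    have hm2 : 2 ≤ m - 1 := by
      have : 56 < m := by exact_mod_cast hm56
      omega
    have hcm : c / m ≤ Real.exp (A / 8) / 4 := by
      have h1 : c / m ≤ Real.exp 1 * K * (K - 1) / κ := by
        rw [div_le_div_iff₀ hm' hκpos]
        rw [lt_div_iff₀ hN] at hκm
        have : 0 ≤ Real.exp 1 * (K - 1) := by
          have : 0 ≤ K - 1 := by linarith
          positivity
        nlinarith
      have h2 : Real.exp 1 * K * (K - 1) / κ ≤ Real.exp (A / 8) / 4 := by
        rw [div_le_div_iff₀ hκpos (by norm_num)]
        have h3 : 56 * K ^ 2 ≤ Real.exp (A / 8) * κ := by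
          calc 56 * K ^ 2 = Real.exp (A / 8) * (56 * (K ^ 2 * Real.exp (-(1 / 8) * A))) := by
                rw [show -(1 / 8) * A = -(A / 8) by ring, Real.exp_neg]
                field_simp
            _ ≤ _ := by gcongr
        have he : Real.exp 1 < 3 := Real.exp_one_lt_d9.trans (by norm_num)
        have h4 : 0 ≤ K * (K - 1) := mul_nonneg (by linarith) (by linarith)
        nlinarith
      exact h1.trans h2
    have hrle : r ≤ 1 / 4 * Real.exp (-(A / 2)) := by
      calc r ≤ Real.exp (A / 8) / 4 * Real.exp (-(A * (1 - ε - s))) := by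
            rw [hr]; gcongr
        _ = 1 / 4 * Real.exp (A / 8 - A * (1 - ε - s)) := by
            rw [sub_eq_add_neg (A / 8), Real.exp_add]; ring
        _ ≤ 1 / 4 * Real.exp (-(A / 2)) := by
            have : s ≤ 1 / 20 := min_le_right _ _
            gcongr
            nlinarith
    have hrpow : r ^ (m - 1) ≤ (1 / 4) ^ (m - 1) * Real.exp (-A) := by
      calc r ^ (m - 1) ≤ (1 / 4 * Real.exp (-(A / 2))) ^ (m - 1) := by gcongr
        _ = (1 / 4) ^ (m - 1) * Real.exp (-(A / 2)) ^ (m - 1) := mul_pow _ _ _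
        _ ≤ (1 / 4) ^ (m - 1) * Real.exp (-(A / 2)) ^ 2 := by
            gcongr (1 / 4) ^ (m - 1) * ?_
            exact pow_le_pow_of_le_one (Real.exp_nonneg _)
              (Real.exp_le_one_iff.2 (by linarith)) hm2
        _ = (1 / 4) ^ (m - 1) * Real.exp (-A) := by
            rw [← Real.exp_nat_mul]
            congr 2
            push_cast
            ring
    have hone : Real.exp (-(A * (1 - ε - s))) ≤ 1 := by
      have : s ≤ 1 / 20 := min_le_right _ _
      apply Real.exp_le_one_iff.2
      nlinarith
    calc c * Real.exp (-(A * (1 - ε - s))) * r ^ (m - 1)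
        ≤ c * 1 * ((1 / 4) ^ (m - 1) * Real.exp (-A)) := by gcongr
      _ = c * Real.exp (-A) * (1 / 4) ^ (m - 1) := by ring
      _ ≤ c * Real.exp (-(1 - ζ - κ) * A) * (1 / 4) ^ (m - 1) := by
          gcongr
          nlinarith

lemma hamStar_le_ham {N K : ℕ} (σ σ' : Fin N → Fin K) (ρ : Equiv.Perm (Fin K)) :
    hamStar σ σ' ≤ ham σ (fun i => ρ (σ' i)) :=
  Finset.inf'_le _ (Finset.mem_univ ρ)

lemma ham_le {N K : ℕ} (σ σ' : Fin N → Fin K) : ham σ σ' ≤ N :=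
  (Finset.card_filter_le _ _).trans_eq (by simp)

lemma ham_eq_zero_of_degenerate {N K : ℕ} (h : N = 0 ∨ K < 2) (σ σ' : Fin N → Fin K) :
    ham σ σ' = 0 := by
  rcases h with rfl | h
  · simp [ham]
  · have : Subsingleton (Fin K) := Fin.subsingleton_iff_le_one.2 (by omega)
    have h : σ = σ' := Subsingleton.elim _ _
    simp [ham, h]

/-- A labelling with few misclassified nodes per block of `σ` has many discordant pairs
relative to its Hamming distance from `σ`. -/
lemma card_discordantPairs_ge_of_aligned {N K : ℕ} (hN : 0 < N) (hK : 0 < K)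
    (σ σ' : Fin N → Fin K) (ε : ℝ)
    (hblock : ∀ k, (1 - ε) * (N : ℝ) / K ≤ (blockCount σ k : ℝ))
    (hnear : ∀ k, ((Finset.univ.filter fun i => σ i = k ∧ σ' i ≠ k).card : ℝ) ≤
      (N : ℝ) / K / 20) :
    2 * ((N : ℝ) / K * (1 - ε - min ((ham σ σ' : ℝ) * K / N) (1 / 20))) * ham σ σ' ≤
      ((discordantPairs σ σ').card : ℝ) := by
  have hN' : (0 : ℝ) < N := by exact_mod_cast hN
  have hK' : (0 : ℝ) < K := by exact_mod_cast hK
  apply two_mul_ham_le_card_discordantPairs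
  intro k
  have h := Finset.card_filter_add_card_filter_not
    (s := Finset.univ.filter fun i => σ i = k) (fun i => σ' i = k)
  rw [Finset.filter_filter, Finset.filter_filter] at h
  have h1 := hnear k
  have h2 := hblock k
  rw [blockCount, ← h] at h2
  push_cast at h2
  have h3 : (Finset.univ.filter fun i => σ i = k ∧ σ' i ≠ k).card ≤ ham σ σ' :=
    Finset.card_le_card fun i hi => by
      simp only [Finset.mem_filter, Finset.mem_univ, true_and] at hi ⊢
      grind
  have h3' : ((Finset.univ.filter fun i => σ i = k ∧ σ' i ≠ k).card : ℝ) ≤ ham σ σ' := by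
    exact_mod_cast h3
  have h4 : ((Finset.univ.filter fun i => σ i = k ∧ σ' i ≠ k).card : ℝ) ≤
      (N : ℝ) / K * min ((ham σ σ' : ℝ) * K / N) (1 / 20) := by
    rw [mul_min_of_nonneg _ _ (by positivity), le_min_iff]
    refine ⟨h3'.trans_eq (by field_simp), h1.trans_eq (by ring)⟩
  have h5 : (1 - ε) * (N : ℝ) / K = (N : ℝ) / K * (1 - ε) := by ring
  rw [h5] at h2
  rw [mul_sub]
  simp only [ne_eq] at h4
  linarith

lemma sum_quarter_pow_pred_le (n : ℕ) :
    ∑ m ∈ Finset.range (n + 1), (1 / 4 : ℝ) ^ (m - 1) ≤ 7 / 3 := by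
  have h : ∑ m ∈ Finset.range n, (1 / 4 : ℝ) ^ m ≤ 4 / 3 := by
    rw [geom_sum_eq (by norm_num), div_le_iff_of_neg (by norm_num)]
    have : (0 : ℝ) ≤ (1 / 4) ^ n := by positivity
    linarith
  rw [Finset.sum_range_succ']
  simp only [Nat.add_sub_cancel]
  norm_num at h ⊢
  linarith

/-- Worst-case upper bound, over balanced labellings, on the expected classification error of
any maximum-likelihood estimator for a homogeneous SBM. -/
theorem mle_upper_bound_minimax
    (N K : ℕ) (S : Type*) [Fintype S]
    (f g : S → ℝ) (hf0 : ∀ x, 0 ≤ f x) (hg0 : ∀ x, 0 ≤ g x)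
    (hf1 : ∑ x, f x = 1) (hg1 : ∑ x, g x = 1)
    (I : ℝ) (hI : I = -2 * Real.log (∑ x, Real.sqrt (f x * g x)))
    (σhat : (PairIdx N → S) → (Fin N → Fin K))
    (hMLE : ∀ x : PairIdx N → S, ∀ σ' : Fin N → Fin K,
      sbmProb f g (σhat x) x ≥ sbmProb f g σ' x)
    (ε ζ : ℝ) (hε0 : 0 ≤ ε) (hεζ : ε ≤ ζ) (hζ : ζ ≤ 1 / 21)
    (κ : ℝ)
    (hκ : κ = 56 * max ((K : ℝ) ^ 2 * Real.exp (-(1 / 8) * ((N : ℝ) * I / K)))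
      ((K : ℝ) / N)) :
    ∀ σ : Fin N → Fin K,
      (∀ k, (1 - ε) * (N : ℝ) / K ≤ (blockCount σ k : ℝ) ∧
        (blockCount σ k : ℝ) ≤ (1 + ε) * (N : ℝ) / K) →
      (∑ x : PairIdx N → S, sbmProb f g σ x * (hamStar σ (σhat x) : ℝ))
        ≤ 8 * Real.exp 1 * N * ((K : ℝ) - 1) *
            Real.exp (-(1 - ζ - κ) * ((N : ℝ) * I / K))
          + (N : ℝ) * (K : ℝ) ^ N *
            Real.exp (-(1 / 4) * (ζ / ((K : ℝ) - 1) - ε) * ((N : ℝ) / K) ^ 2 * I) := by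
  intro σ hσ
  have hw0 : 0 ≤ ∑ x, Real.sqrt (f x * g x) := Finset.sum_nonneg fun _ _ => Real.sqrt_nonneg _
  have hw1 := sum_sqrt_mul_le_one hf0 hg0 hf1 hg1
  have hI0 : 0 ≤ I := by
    have := Real.log_nonpos hw0 hw1
    linarith
  have hP0 := fun σ' : Fin N → Fin K => sbmProb_nonneg hf0 hg0 σ'
  by_cases hdeg : N = 0 ∨ K < 2
  · have hzero : ∀ x, hamStar σ (σhat x) = 0 := fun x =>
      Nat.le_zero.1 ((hamStar_le_ham σ (σhat x) 1).trans_eq (ham_eq_zero_of_degenerate hdeg _ _))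
    have hNK : 0 ≤ (N : ℝ) * ((K : ℝ) - 1) := by
      rcases Nat.eq_zero_or_pos N with rfl | hN
      · simp
      · have hK : 1 ≤ K := Fin.pos_iff_nonempty.2 ⟨σ ⟨0, hN⟩⟩
        have : (1 : ℝ) ≤ K := by exact_mod_cast hK
        exact mul_nonneg (Nat.cast_nonneg _) (by linarith)
    simp only [hzero, Nat.cast_zero, mul_zero, Finset.sum_const_zero]
    rw [mul_assoc (8 * Real.exp 1)]
    positivity
  push Not at hdeg
  obtain ⟨hN0, hK⟩ := hdeg
  have hN : 0 < N := Nat.pos_of_ne_zero hN0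
  have hN' : (0 : ℝ) < N := by exact_mod_cast hN
  have hK' : (2 : ℝ) ≤ K := by exact_mod_cast hK
  have hK1 : (0 : ℝ) < (K : ℝ) - 1 := by linarith
  set L : ℝ := (N : ℝ) / K with hL
  have hLpos : 0 < L := by positivity
  set A : ℝ := (N : ℝ) * I / K with hA
  have hA0 : 0 ≤ A := by positivity
  set q : ℝ := Real.exp 1 * N * ((K : ℝ) - 1) * Real.exp (-(1 - ζ - κ) * A) with hq
  have hqpos : 0 < q := by positivity
  set D : ℝ := (1 / 2) * (ζ / ((K : ℝ) - 1) - ε) * L ^ 2 with hD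
  have hDle : D ≤ L ^ 2 / 42 := by
    have h1 : ζ / ((K : ℝ) - 1) ≤ 1 / 21 :=
      (div_le_self (hε0.trans hεζ) (by linarith)).trans hζ
    have : 0 < L ^ 2 := by positivity
    rw [hD]
    nlinarith
  set far : Finset (Fin N → Fin K) := Finset.univ.filter fun σ' =>
    D ≤ ((discordantPairs σ σ').card : ℝ) with hfar
  set near : Finset (Fin N → Fin K) := Finset.univ.filter fun σ' =>
    (∀ k, ((Finset.univ.filter fun i => σ i = k ∧ σ' i ≠ k).card : ℝ) ≤ L / 20) ∧
      4 * q < ham σ σ' with hnear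
  have hblock : ∀ k, 20 / 21 * L ≤ (blockCount σ k : ℝ) := fun k => by
    refine le_trans ?_ (hσ k).1
    rw [mul_div_assoc, ← hL]
    gcongr
    linarith
  have hle_sqrt : ∀ x (σ' : Fin N → Fin K), sbmProb f g σ x ≤ sbmProb f g σ' x →
      sbmProb f g σ x ≤ Real.sqrt (sbmProb f g σ x * sbmProb f g σ' x) := fun x σ' h =>
    Real.le_sqrt_of_sq_le (by
      rw [sq]
      exact mul_le_mul_of_nonneg_left h (hP0 σ x))
  have hpoint : ∀ x, sbmProb f g σ x * (hamStar σ (σhat x) : ℝ) ≤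
      4 * q * sbmProb f g σ x +
      (∑ σ' ∈ far, N * Real.sqrt (sbmProb f g σ x * sbmProb f g σ' x)) +
      ∑ σ' ∈ near, ham σ σ' * Real.sqrt (sbmProb f g σ x * sbmProb f g σ' x) := by
    intro x
    have hfar0 : 0 ≤ ∑ σ' ∈ far, N * Real.sqrt (sbmProb f g σ x * sbmProb f g σ' x) :=
      Finset.sum_nonneg fun _ _ => by positivity
    have hnear0 :
        0 ≤ ∑ σ' ∈ near, ham σ σ' * Real.sqrt (sbmProb f g σ x * sbmProb f g σ' x) :=
      Finset.sum_nonneg fun _ _ => by positivity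
    have hq0 : 0 ≤ 4 * q * sbmProb f g σ x := mul_nonneg (by positivity) (hP0 σ x)
    by_cases hx : D ≤ ((discordantPairs σ (σhat x)).card : ℝ)
    · have hmem : σhat x ∈ far := Finset.mem_filter.2 ⟨Finset.mem_univ _, hx⟩
      have h1 := Finset.single_le_sum
        (f := fun σ' => N * Real.sqrt (sbmProb f g σ x * sbmProb f g σ' x))
        (fun _ _ => by positivity) hmem
      have h2 : (hamStar σ (σhat x) : ℝ) ≤ N := by
        exact_mod_cast (hamStar_le_ham σ (σhat x) 1).trans (ham_le _ _)
      have h3 := mul_le_mul (hle_sqrt x _ (hMLE x σ)) h2 (by positivity) (by positivity)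
      linarith
    · obtain ⟨ρ, hρ⟩ := exists_perm_aligned σ (σhat x) L hLpos hblock
        ((not_le.1 hx).trans_le hDle)
      set σ' : Fin N → Fin K := fun i => ρ (σhat x i) with hσ'
      have h2 : (hamStar σ (σhat x) : ℝ) ≤ ham σ σ' := by
        exact_mod_cast hamStar_le_ham σ (σhat x) ρ
      by_cases hm : 4 * q < ham σ σ'
      · have hmem : σ' ∈ near := Finset.mem_filter.2 ⟨Finset.mem_univ _, hρ, hm⟩
        have h1 := Finset.single_le_sum
          (f := fun σ' => ham σ σ' * Real.sqrt (sbmProb f g σ x * sbmProb f g σ' x))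
          (fun _ _ => by positivity) hmem
        have h4 : sbmProb f g σ x ≤ sbmProb f g σ' x := by
          rw [hσ', sbmProb_perm]
          exact hMLE x σ
        have h3 := mul_le_mul (hle_sqrt x _ h4) h2 (by positivity) (by positivity)
        linarith
      · have h3 := mul_le_mul_of_nonneg_left (h2.trans (not_lt.1 hm)) (hP0 σ x)
        linarith
  have hsum := Finset.sum_le_sum fun x (_ : x ∈ Finset.univ) => hpoint x
  rw [Finset.sum_add_distrib, Finset.sum_add_distrib, ← Finset.mul_sum,
    sum_sbmProb hf1 hg1, mul_one, Finset.sum_comm, Finset.sum_comm (t := near)] at hsum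
  simp only [← Finset.mul_sum, sum_sqrt_sbmProb_mul hf0 hg0 hf1 hg1] at hsum
  have hfar_le : (N : ℝ) * ∑ σ' ∈ far,
      (∑ s, Real.sqrt (f s * g s)) ^ (discordantPairs σ σ').card ≤
      (N : ℝ) * (K : ℝ) ^ N *
        Real.exp (-(1 / 4) * (ζ / ((K : ℝ) - 1) - ε) * L ^ 2 * I) := by
    rw [mul_assoc]
    gcongr
    calc ∑ σ' ∈ far, (∑ s, Real.sqrt (f s * g s)) ^ (discordantPairs σ σ').card
        ≤ ∑ σ' ∈ far, Real.exp (-(1 / 4) * (ζ / ((K : ℝ) - 1) - ε) * L ^ 2 * I) := by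
          refine Finset.sum_le_sum fun σ' hσ' => (pow_le_exp_of_eq_log hw0 hI _).trans ?_
          have := mul_le_mul_of_nonneg_right (Finset.mem_filter.1 hσ').2 hI0
          rw [hD] at this
          apply Real.exp_le_exp.2
          linarith
      _ = far.card * Real.exp (-(1 / 4) * (ζ / ((K : ℝ) - 1) - ε) * L ^ 2 * I) := by
          rw [Finset.sum_const, nsmul_eq_mul]
      _ ≤ _ := by
          gcongr
          exact_mod_cast (Finset.card_filter_le _ _).trans_eq (by simp)
  have hnear_le : ∑ σ' ∈ near, (ham σ σ' : ℝ) *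
      (∑ s, Real.sqrt (f s * g s)) ^ (discordantPairs σ σ').card ≤ 7 / 3 * q := by
    calc ∑ σ' ∈ near, (ham σ σ' : ℝ) *
          (∑ s, Real.sqrt (f s * g s)) ^ (discordantPairs σ σ').card
        ≤ ∑ σ' ∈ near, (ham σ σ' : ℝ) *
          Real.exp (-(ham σ σ' * A * (1 - ε - min ((ham σ σ' : ℝ) * K / N) (1 / 20)))) := by
          refine Finset.sum_le_sum fun σ' hσ' => ?_
          have h1 := card_discordantPairs_ge_of_aligned hN (by omega) σ σ' ε
            (fun k => (hσ k).1) (Finset.mem_filter.1 hσ').2.1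
          have h2 := mul_le_mul_of_nonneg_right h1 hI0
          gcongr
          refine (pow_le_exp_of_eq_log hw0 hI _).trans (Real.exp_le_exp.2 ?_)
          have h3 : A = N / K * I := by rw [hA]; ring
          rw [h3]
          linarith
      _ = ∑ m ∈ Finset.range (N + 1), ∑ σ' ∈ near with ham σ σ' = m, (ham σ σ' : ℝ) *
          Real.exp (-(ham σ σ' * A * (1 - ε - min ((ham σ σ' : ℝ) * K / N) (1 / 20)))) :=
          (Finset.sum_fiberwise_of_maps_to (fun σ' _ =>
            Finset.mem_range.2 (Nat.lt_succ_of_le (ham_le σ σ'))) _).symm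
      _ ≤ ∑ m ∈ Finset.range (N + 1), q * (1 / 4) ^ (m - 1) := by
          refine Finset.sum_le_sum fun m _ => ?_
          by_cases hm : 4 * q < m
          · have hmpos : 0 < m := by
              have : (0 : ℝ) < m := by linarith
              exact_mod_cast this
            rw [Finset.sum_congr rfl (g := fun _ => (m : ℝ) *
              Real.exp (-(m * A * (1 - ε - min ((m : ℝ) * K / N) (1 / 20)))))
              (fun σ' hσ' => by rw [(Finset.mem_filter.1 hσ').2]),
              Finset.sum_const, nsmul_eq_mul]
            have hcard : ((near.filter fun σ' => ham σ σ' = m).card : ℝ) ≤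
                (Real.exp 1 * N * ((K : ℝ) - 1) / m) ^ m := by
              refine le_trans ?_ (card_ham_eq_le hN hK σ hmpos)
              exact_mod_cast Finset.card_le_card
                (Finset.filter_subset_filter _ (Finset.subset_univ _))
            refine (mul_le_mul_of_nonneg_right hcard (by positivity)).trans ?_
            refine sphere_term_le hN' hK' hA0 hε0 hεζ hζ ?_ ?_ m hmpos hm
            · rw [hκ]
              gcongr
              exact le_max_left _ _
            · rw [hκ]
              gcongr
              exact le_max_right _ _
          · rw [Finset.filter_eq_empty_iff.2, Finset.sum_empty]
            · positivity
            · rintro σ' hσ' rfl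
              exact hm (Finset.mem_filter.1 hσ').2.2
      _ = q * ∑ m ∈ Finset.range (N + 1), (1 / 4) ^ (m - 1) := by rw [Finset.mul_sum]
      _ ≤ q * (7 / 3) := by
          gcongr
          exact sum_quarter_pow_pred_le N
      _ = 7 / 3 * q := mul_comm _ _
  have hq8 : 8 * Real.exp 1 * N * ((K : ℝ) - 1) * Real.exp (-(1 - ζ - κ) * A) = 8 * q := by
    rw [hq]; ring
  rw [hq8]
  linarith
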